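/- Assume the standard setup with r < t, G not isomorphic to the star K_{1,e}, and e + s ≥ c_r, where s ≥ 1. Let r + 1 ≤ i ≤ t (so Vᵢ is a singleton consisting of a pendant vertex). If e < c₁, then χ_la(G(Vᵢ,s)) = s + t − r. -/

import Mathlib

open Finset
open scoped Classical

namespace LocalAntimagic

variable {V : Type*}

/-- The induced vertex label: sum of the labels of edges incident to `v`. -/
noncomputable def vertexSum [Fintype V] (G : SimpleGraph V) (f : Sym2 V → ℕ) (v : V) : ℕ :=
  ∑ e ∈ G.incidenceFinset v, f e

/-- `f` is a local antimagic labeling of `G`: a bijection from the edge set onto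
`{1, …, |E|}` whose induced vertex labels distinguish adjacent vertices. -/
def IsLocalAntimagic [Fintype V] (G : SimpleGraph V) (f : Sym2 V → ℕ) : Prop :=
  Set.BijOn f G.edgeSet (Set.Icc 1 G.edgeFinset.card) ∧
  ∀ ⦃u v : V⦄, G.Adj u v → vertexSum G f u ≠ vertexSum G f v

/-- The color number `c(f)`: the number of distinct induced vertex labels. -/
noncomputable def colorCount [Fintype V] (G : SimpleGraph V) (f : Sym2 V → ℕ) : ℕ :=
  (Finset.univ.image (vertexSum G f)).card

/-- The local antimagic chromatic number. -/
noncomputable def chiLA [Fintype V] (G : SimpleGraph V) : ℕ :=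
  sInf {n | ∃ f, IsLocalAntimagic G f ∧ colorCount G f = n}

/-- A pendant vertex is a vertex of degree 1. -/
def IsPendant [Fintype V] (G : SimpleGraph V) (v : V) : Prop :=
  G.degree v = 1

/-- The number of pendant vertices of `G`. -/
noncomputable def pendantCount [Fintype V] (G : SimpleGraph V) : ℕ :=
  (Finset.univ.filter (fun v => IsPendant G v)).card

/-- `G(S, s)`: the graph obtained from `G` by attaching `s` new pendant edges to every
vertex of `S`.  The new pendant vertex attached to `w ∈ S` via the `j`-th new edge is
`Sum.inr (w, j)`; the original graph lives on the `Sum.inl` vertices. -/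
def attachPendants (G : SimpleGraph V) (S : Finset V) (s : ℕ) :
    SimpleGraph (V ⊕ (S × Fin s)) :=
  SimpleGraph.fromRel (fun a b =>
    (∃ u v : V, a = Sum.inl u ∧ b = Sum.inl v ∧ G.Adj u v) ∨
    (∃ (w : S) (j : Fin s), a = Sum.inl (w : V) ∧ b = Sum.inr (w, j)))

/-- The standard setup: `G` is a connected graph with at least `2` edges and
`χ_la(G) = t ≥ 2`; `f` is a local antimagic labeling of `G` with `c(f) = t` whose color
classes are `Vset 1, …, Vset t` (each nonempty, with `f⁺ ≡ c i` on `Vset i`, and the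
colors `c 1, …, c t` pairwise distinct); every non-pendant vertex lies in
`Vset 1 ∪ ⋯ ∪ Vset r` where `1 ≤ r ≤ t`; each `Vset i` with `r + 1 ≤ i ≤ t` is a
singleton consisting of a pendant vertex; `c 1 < c 2 < ⋯ < c r` and
`c (r+1) < c (r+2) < ⋯ < c t`. -/
structure StandardSetup [Fintype V] (G : SimpleGraph V) (f : Sym2 V → ℕ)
    (t r : ℕ) (Vset : ℕ → Finset V) (c : ℕ → ℕ) : Prop where
  connected : G.Connected
  two_le_card_edges : 2 ≤ G.edgeFinset.card
  chiLA_eq : chiLA G = t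
  two_le_t : 2 ≤ t
  antimagic : IsLocalAntimagic G f
  colorCount_eq : colorCount G f = t
  color_on_class : ∀ i ∈ Finset.Icc 1 t, ∀ v ∈ Vset i, vertexSum G f v = c i
  class_cover : ∀ v : V, ∃ i ∈ Finset.Icc 1 t, v ∈ Vset i
  class_nonempty : ∀ i ∈ Finset.Icc 1 t, (Vset i).Nonempty
  color_injective : ∀ i ∈ Finset.Icc 1 t, ∀ j ∈ Finset.Icc 1 t, i ≠ j → c i ≠ c j
  one_le_r : 1 ≤ r
  r_le_t : r ≤ t
  nonpendant_mem : ∀ v : V, ¬ IsPendant G v → ∃ i ∈ Finset.Icc 1 r, v ∈ Vset i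
  pendant_singleton : ∀ i ∈ Finset.Icc (r + 1) t, ∃ v : V, IsPendant G v ∧ Vset i = {v}
  c_strictMono_low : ∀ i j : ℕ, 1 ≤ i → i < j → j ≤ r → c i < c j
  c_strictMono_high : ∀ i j : ℕ, r + 1 ≤ i → i < j → j ≤ t → c i < c j

/-- `b`: the number of pendant vertices of `G` lying in `Vset 1 ∪ ⋯ ∪ Vset r`. -/
noncomputable def pendantsInLow [Fintype V] (G : SimpleGraph V)
    (Vset : ℕ → Finset V) (r : ℕ) : ℕ :=
  (((Finset.Icc 1 r).biUnion Vset).filter (fun v => IsPendant G v)).card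

lemma pendantCount_eq_card [Fintype V] (G : SimpleGraph V) :
    pendantCount G = (Finset.univ.filter (IsPendant G)).card := rfl

lemma vertexSum_eq_sum [Fintype V] (G : SimpleGraph V) (f : Sym2 V → ℕ) (v : V) :
    vertexSum G f v = ∑ w, if G.Adj v w then f s(v, w) else 0 := by
  rw [← Finset.sum_filter]
  symm
  refine Finset.sum_bij (fun w _ => s(v, w)) ?_ ?_ ?_ ?_
  · intro w hw
    simpa [SimpleGraph.mem_incidenceFinset, SimpleGraph.mk'_mem_incidenceSet_iff] using hw
  · intro a _ b _ h
    exact Sym2.congr_right.mp h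
  · intro e he
    rw [SimpleGraph.mem_incidenceFinset] at he
    obtain ⟨w, rfl⟩ := Sym2.mem_iff_exists.mp he.2
    exact ⟨w, by simpa using he.1, rfl⟩
  · intros
    rfl

lemma IsPendant.exists_vertexSum_eq [Fintype V] {G : SimpleGraph V} {v : V}
    (hv : IsPendant G v) (f : Sym2 V → ℕ) :
    ∃ w, G.Adj v w ∧ vertexSum G f v = f s(v, w) := by
  obtain ⟨w, hw, huniq⟩ := SimpleGraph.degree_eq_one_iff_existsUnique_adj.mp hv
  refine ⟨w, hw, ?_⟩
  rw [vertexSum_eq_sum, Finset.sum_eq_single w]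
  · simp [hw]
  · intro x _ hx
    rw [if_neg fun h => hx (huniq x h)]
  · simp

lemma IsLocalAntimagic.vertexSum_pendant_mem [Fintype V] {G : SimpleGraph V} {f : Sym2 V → ℕ}
    (hf : IsLocalAntimagic G f) {v : V} (hv : IsPendant G v) :
    vertexSum G f v ∈ Set.Icc 1 G.edgeFinset.card := by
  obtain ⟨w, hw, h⟩ := hv.exists_vertexSum_eq f
  rw [h]
  exact hf.1.mapsTo hw

lemma IsLocalAntimagic.injOn_pendant [Fintype V] {G : SimpleGraph V} {f : Sym2 V → ℕ}
    (hf : IsLocalAntimagic G f) : Set.InjOn (vertexSum G f) {v | IsPendant G v} := by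
  intro v hv w hw h
  obtain ⟨x, hx, hvx⟩ := IsPendant.exists_vertexSum_eq hv f
  obtain ⟨y, hy, hwy⟩ := IsPendant.exists_vertexSum_eq hw f
  have hedge : s(v, x) = s(w, y) := hf.1.injOn hx hy (by rw [← hvx, ← hwy, h])
  rcases Sym2.eq_iff.mp hedge with ⟨hvw, -⟩ | ⟨rfl, rfl⟩
  · exact hvw
  · exact absurd h (hf.2 hx)

lemma le_vertexSum [Fintype V] {G : SimpleGraph V} {v w : V} (h : G.Adj v w)
    (f : Sym2 V → ℕ) : f s(v, w) ≤ vertexSum G f v := by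
  rw [vertexSum_eq_sum]
  simpa [h] using Finset.single_le_sum
    (f := fun w => if G.Adj v w then f s(v, w) else 0) (fun _ _ => Nat.zero_le _)
    (Finset.mem_univ w)

/-- Pendant vertices receive pairwise distinct colors, and some end of the edge with the largest
label receives a color larger than all of them. -/
lemma IsLocalAntimagic.pendantCount_lt_colorCount [Fintype V] {G : SimpleGraph V}
    {f : Sym2 V → ℕ} (hf : IsLocalAntimagic G f) (hG : 1 ≤ G.edgeFinset.card) :
    pendantCount G < colorCount G f := by
  have hlarge : ∃ x, G.edgeFinset.card < vertexSum G f x := by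
    obtain ⟨e, he, hmax⟩ := hf.1.surjOn (Set.right_mem_Icc.mpr hG)
    induction e using Sym2.ind with
    | _ v w =>
      have hvw : G.Adj v w := he
      have hv := le_vertexSum hvw f
      have hw := le_vertexSum hvw.symm f
      rw [Sym2.eq_swap] at hw
      rcases lt_or_gt_of_ne (hf.2 hvw) with h | h
      · exact ⟨w, by omega⟩
      · exact ⟨v, by omega⟩
  obtain ⟨x, hx⟩ := hlarge
  have hinj : ((Finset.univ.filter (IsPendant G)).image (vertexSum G f)).card
      = pendantCount G :=
    Finset.card_image_of_injOn (hf.injOn_pendant.mono (by intro v; simp))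
  rw [← hinj]
  refine Finset.card_lt_card (Finset.ssubset_iff_of_subset
    (Finset.image_subset_image (Finset.subset_univ _)) |>.mpr
    ⟨vertexSum G f x, Finset.mem_image_of_mem _ (Finset.mem_univ x), ?_⟩)
  simp only [Finset.mem_image, Finset.mem_filter, Finset.mem_univ, true_and, not_exists, not_and]
  intro v hv hvx
  have := (hf.vertexSum_pendant_mem hv).2
  omega

section AttachPendants

variable (G : SimpleGraph V) (S : Finset V) (s : ℕ)

@[simp]
lemma attachPendants_adj_inl_inl (u v : V) :
    (attachPendants G S s).Adj (Sum.inl u) (Sum.inl v) ↔ G.Adj u v := by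
  simp only [attachPendants, SimpleGraph.fromRel_adj]
  constructor
  · rintro ⟨-, (⟨a, b, ha, hb, h⟩ | ⟨w, j, -, hb⟩) | (⟨a, b, ha, hb, h⟩ | ⟨w, j, -, hb⟩)⟩
    · cases ha; cases hb; exact h
    · cases hb
    · cases ha; cases hb; exact h.symm
    · cases hb
  · intro h
    exact ⟨by simpa using h.ne, Or.inl (Or.inl ⟨u, v, rfl, rfl, h⟩)⟩

@[simp]
lemma attachPendants_adj_inl_inr (v : V) (p : S × Fin s) :
    (attachPendants G S s).Adj (Sum.inl v) (Sum.inr p) ↔ v = p.1 := by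
  simp only [attachPendants, SimpleGraph.fromRel_adj]
  constructor
  · rintro ⟨-, (⟨a, b, ha, hb, h⟩ | ⟨w, j, ha, hb⟩) | (⟨a, b, ha, hb, h⟩ | ⟨w, j, ha, hb⟩)⟩
    · cases hb
    · cases ha; cases hb; rfl
    · cases ha
    · cases ha
  · rintro rfl
    exact ⟨by simp, Or.inl (Or.inr ⟨p.1, p.2, rfl, rfl⟩)⟩

@[simp]
lemma attachPendants_adj_inr_inl (v : V) (p : S × Fin s) :
    (attachPendants G S s).Adj (Sum.inr p) (Sum.inl v) ↔ v = p.1 := by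
  rw [SimpleGraph.adj_comm, attachPendants_adj_inl_inr]

@[simp]
lemma attachPendants_not_adj_inr_inr (p q : S × Fin s) :
    ¬ (attachPendants G S s).Adj (Sum.inr p) (Sum.inr q) := by
  simp [attachPendants]

lemma isPendant_attachPendants_inr [Fintype V] (p : S × Fin s) :
    IsPendant (attachPendants G S s) (Sum.inr p) := by
  refine SimpleGraph.degree_eq_one_iff_existsUnique_adj.mpr ⟨Sum.inl p.1, by simp, ?_⟩
  rintro (v | q) h
  · simpa using h
  · simp at h

variable {G S} in
lemma IsPendant.attachPendants_inl [Fintype V] {v : V} (hv : IsPendant G v) (hvS : v ∉ S) :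
    IsPendant (attachPendants G S s) (Sum.inl v) := by
  obtain ⟨w, hw, huniq⟩ := SimpleGraph.degree_eq_one_iff_existsUnique_adj.mp hv
  refine SimpleGraph.degree_eq_one_iff_existsUnique_adj.mpr ⟨Sum.inl w, by simpa using hw, ?_⟩
  rintro (x | q) h
  · simpa using huniq x (by simpa using h)
  · rw [attachPendants_adj_inl_inr] at h
    exact absurd (h ▸ q.1.2) hvS

variable {G} in
lemma pendantCount_add_le [Fintype V] (u : V) :
    pendantCount G + s ≤ pendantCount (attachPendants G {u} s) + 1 := by
  have hsub : ((Finset.univ.filter (IsPendant G)).erase u).disjSum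
      (Finset.univ : Finset (({u} : Finset V) × Fin s)) ⊆
      Finset.univ.filter (IsPendant (attachPendants G {u} s)) := by
    intro x hx
    rcases Finset.mem_disjSum.mp hx with ⟨v, hv, rfl⟩ | ⟨p, -, rfl⟩
    · simp only [Finset.mem_erase, Finset.mem_filter, Finset.mem_univ, true_and] at hv ⊢
      exact hv.2.attachPendants_inl s (by simpa using hv.1)
    · simpa using isPendant_attachPendants_inr G {u} s p
  have hcard := Finset.card_le_card hsub
  rw [Finset.card_disjSum] at hcard
  have herase := Finset.pred_card_le_card_erase (s := Finset.univ.filter (IsPendant G)) (a := u)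
  simp only [Finset.card_univ, Fintype.card_prod, Fintype.card_coe, Finset.card_singleton,
    Fintype.card_fin, one_mul] at hcard
  simp only [pendantCount_eq_card]
  omega

/-- The labeling of `G(S, s)` that agrees with `f` on `G` and gives the `j`-th new edge at a
vertex of `S` the label `e + j + 1`. -/
def extendLabeling (f : Sym2 V → ℕ) (e : ℕ) : Sym2 (V ⊕ (S × Fin s)) → ℕ :=
  Sym2.lift ⟨fun a b => match a, b with
    | Sum.inl u, Sum.inl v => f s(u, v)
    | Sum.inl _, Sum.inr p => e + p.2 + 1
    | Sum.inr p, Sum.inl _ => e + p.2 + 1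
    | Sum.inr _, Sum.inr _ => 0, by
      rintro (a | a) (b | b)
      · exact congrArg f Sym2.eq_swap
      all_goals rfl⟩

variable (f : Sym2 V → ℕ) (e : ℕ)

@[simp]
lemma extendLabeling_inl_inl (u v : V) :
    extendLabeling S s f e s(Sum.inl u, Sum.inl v) = f s(u, v) := rfl

@[simp]
lemma extendLabeling_inl_inr (v : V) (p : S × Fin s) :
    extendLabeling S s f e s(Sum.inl v, Sum.inr p) = e + p.2 + 1 := rfl

@[simp]
lemma extendLabeling_inr_inl (v : V) (p : S × Fin s) :
    extendLabeling S s f e s(Sum.inr p, Sum.inl v) = e + p.2 + 1 := rfl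

lemma vertexSum_extendLabeling_inl [Fintype V] (v : V) :
    vertexSum (attachPendants G S s) (extendLabeling S s f e) (Sum.inl v) =
      vertexSum G f v + ∑ p : S × Fin s, if v = p.1 then e + p.2 + 1 else 0 := by
  simp [vertexSum_eq_sum, Fintype.sum_sum_type]

lemma vertexSum_extendLabeling_inl_of_notMem [Fintype V] {v : V} (hv : v ∉ S) :
    vertexSum (attachPendants G S s) (extendLabeling S s f e) (Sum.inl v) =
      vertexSum G f v := by
  rw [vertexSum_extendLabeling_inl, Finset.sum_eq_zero, add_zero]
  intro p _
  rw [if_neg]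
  intro h
  exact hv (h ▸ p.1.2)

lemma vertexSum_extendLabeling_inr [Fintype V] (p : S × Fin s) :
    vertexSum (attachPendants G S s) (extendLabeling S s f e) (Sum.inr p) = e + p.2 + 1 := by
  simp [vertexSum_eq_sum, Fintype.sum_sum_type]

variable {G f} in
lemma bijOn_extendLabeling (u : V) (hf : Set.BijOn f G.edgeSet (Set.Icc 1 e)) :
    Set.BijOn (extendLabeling {u} s f e) (attachPendants G {u} s).edgeSet
      (Set.Icc 1 (e + s)) := by
  have hedge : ∀ x ∈ (attachPendants G {u} s).edgeSet,
      (∃ a b, G.Adj a b ∧ x = s(Sum.inl a, Sum.inl b)) ∨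
      ∃ p, x = s(Sum.inl u, Sum.inr p) := by
    intro x hx
    induction x using Sym2.ind with
    | _ a b =>
      rw [SimpleGraph.mem_edgeSet] at hx
      rcases a with a | p <;> rcases b with b | q
      · exact Or.inl ⟨a, b, by simpa using hx, rfl⟩
      · rw [attachPendants_adj_inl_inr] at hx
        exact Or.inr ⟨q, by rw [hx, Finset.mem_singleton.mp q.1.2]⟩
      · rw [attachPendants_adj_inr_inl] at hx
        exact Or.inr ⟨p, by rw [hx, Finset.mem_singleton.mp p.1.2, Sym2.eq_swap]⟩
      · simp at hx
  have hlabel : ∀ {a b}, G.Adj a b → 1 ≤ f s(a, b) ∧ f s(a, b) ≤ e :=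
    fun {a b} h => hf.mapsTo (G.mem_edgeSet.mpr h)
  refine ⟨?_, ?_, ?_⟩
  · intro x hx
    rcases hedge x hx with ⟨a, b, hab, rfl⟩ | ⟨p, rfl⟩
    · have := hlabel hab
      simp only [extendLabeling_inl_inl, Set.mem_Icc]
      omega
    · simp only [extendLabeling_inl_inr, Set.mem_Icc]
      omega
  · intro x hx y hy hxy
    rcases hedge x hx with ⟨a, b, hab, rfl⟩ | ⟨p, rfl⟩ <;>
      rcases hedge y hy with ⟨c, d, hcd, rfl⟩ | ⟨q, rfl⟩
    · have h := hf.injOn (G.mem_edgeSet.mpr hab) (G.mem_edgeSet.mpr hcd) hxy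
      exact congrArg (Sym2.map Sum.inl) h
    · have := hlabel hab
      simp only [extendLabeling_inl_inl, extendLabeling_inl_inr] at hxy
      omega
    · have := hlabel hcd
      simp only [extendLabeling_inl_inl, extendLabeling_inl_inr] at hxy
      omega
    · simp only [extendLabeling_inl_inr] at hxy
      rw [Prod.ext (Subsingleton.elim p.1 q.1) (Fin.ext (show (p.2 : ℕ) = q.2 by omega))]
  · intro n hn
    by_cases hne : n ≤ e
    · obtain ⟨x, hx, rfl⟩ := hf.surjOn ⟨hn.1, hne⟩
      induction x using Sym2.ind with
      | _ a b => exact ⟨s(Sum.inl a, Sum.inl b), by simpa using hx, rfl⟩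
    · have hn2 := hn.2
      refine ⟨s(Sum.inl u, Sum.inr (⟨u, by simp⟩, ⟨n - e - 1, by omega⟩)), by simp, ?_⟩
      simp only [extendLabeling_inl_inr]
      omega

variable {s} in
lemma lt_vertexSum_extendLabeling_inl_self [Fintype V] {u : V} (hs : 1 ≤ s)
    (hu : 1 ≤ vertexSum G f u) :
    e + s < vertexSum (attachPendants G {u} s) (extendLabeling {u} s f e) (Sum.inl u) := by
  have hlast := Finset.single_le_sum
    (f := fun p : ({u} : Finset V) × Fin s => if u = p.1 then e + p.2 + 1 else 0)
    (fun _ _ => Nat.zero_le _)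
    (Finset.mem_univ (⟨u, by simp⟩, ⟨s - 1, by omega⟩))
  rw [vertexSum_extendLabeling_inl]
  simp only [if_true] at hlast
  omega

end AttachPendants

lemma edgeFinset_card_of_bijOn [Fintype V] {G : SimpleGraph V} {f : Sym2 V → ℕ} {n : ℕ}
    (hf : Set.BijOn f G.edgeSet (Set.Icc 1 n)) : G.edgeFinset.card = n := by
  have h := hf.injOn.ncard_image
  rw [hf.image_eq, ← SimpleGraph.coe_edgeFinset, Set.ncard_coe_finset,
    ← Finset.coe_Icc, Set.ncard_coe_finset, Nat.card_Icc] at h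
  omega

/-- If every color at a neighbour of the pendant vertex `u` is at most `e + s`, then `f` extends
to a local antimagic labeling of `G({u}, s)`. -/
lemma IsLocalAntimagic.extendLabeling [Fintype V] {G : SimpleGraph V} {f : Sym2 V → ℕ}
    (hf : IsLocalAntimagic G f) {u : V} (hu : IsPendant G u) {s : ℕ} (hs : 1 ≤ s)
    (hadj : ∀ v, G.Adj u v → vertexSum G f v ≤ G.edgeFinset.card + s) :
    IsLocalAntimagic (attachPendants G {u} s)
      (extendLabeling {u} s f G.edgeFinset.card) := by
  have hbij := bijOn_extendLabeling s G.edgeFinset.card u hf.1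
  have hlarge := lt_vertexSum_extendLabeling_inl_self G f G.edgeFinset.card hs
    (hf.vertexSum_pendant_mem hu).1
  refine ⟨by rwa [edgeFinset_card_of_bijOn hbij], ?_⟩
  have hinl : ∀ v, G.Adj u v → vertexSum (attachPendants G {u} s)
      (LocalAntimagic.extendLabeling {u} s f G.edgeFinset.card) (Sum.inl v) ≤
        G.edgeFinset.card + s := by
    intro v hv
    rw [vertexSum_extendLabeling_inl_of_notMem _ _ _ _ _ (by simpa using hv.ne')]
    exact hadj v hv
  rintro (v | p) (w | q) h
  · rw [attachPendants_adj_inl_inl] at h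
    by_cases hvu : v = u
    · subst hvu
      exact ((hinl w h).trans_lt hlarge).ne'
    by_cases hwu : w = u
    · subst hwu
      exact ((hinl v h.symm).trans_lt hlarge).ne
    rw [vertexSum_extendLabeling_inl_of_notMem _ _ _ _ _ (by simpa using hvu),
      vertexSum_extendLabeling_inl_of_notMem _ _ _ _ _ (by simpa using hwu)]
    exact hf.2 h
  · rw [attachPendants_adj_inl_inr] at h
    rw [h, Finset.mem_singleton.mp q.1.2, vertexSum_extendLabeling_inr]
    omega
  · rw [attachPendants_adj_inr_inl] at h
    rw [h, Finset.mem_singleton.mp p.1.2, vertexSum_extendLabeling_inr]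
    omega
  · simp at h

namespace StandardSetup

variable [Fintype V] {G : SimpleGraph V} {f : Sym2 V → ℕ} {t r : ℕ} {Vset : ℕ → Finset V}
  {c : ℕ → ℕ}

lemma sub_le_pendantCount (setup : StandardSetup G f t r Vset c) :
    t - r ≤ pendantCount G := by
  have hinj : Set.InjOn c (Finset.Icc (r + 1) t) := by
    intro i hi j hj hij
    by_contra hne
    simp only [Finset.coe_Icc, Set.mem_Icc] at hi hj
    exact setup.color_injective i (Finset.mem_Icc.mpr (by omega)) j
      (Finset.mem_Icc.mpr (by omega)) hne hij
  have hsub : (Finset.Icc (r + 1) t).image c ⊆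
      (Finset.univ.filter (IsPendant G)).image (vertexSum G f) := by
    intro n hn
    obtain ⟨i, hi, rfl⟩ := Finset.mem_image.mp hn
    obtain ⟨v, hv, hVi⟩ := setup.pendant_singleton i hi
    rw [Finset.mem_Icc] at hi
    exact Finset.mem_image.mpr ⟨v, by simpa using hv,
      setup.color_on_class i (Finset.mem_Icc.mpr (by omega)) v (by simp [hVi])⟩
  have hcard := (Finset.card_le_card hsub).trans Finset.card_image_le
  rw [Finset.card_image_of_injOn hinj, Nat.card_Icc] at hcard
  simp only [pendantCount_eq_card]
  omega

lemma low_color_mem (setup : StandardSetup G f t r Vset c) {j : ℕ} (hj : 1 ≤ j) (hjr : j ≤ r) :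
    c 1 ≤ c j ∧ c j ≤ c r := by
  constructor
  · rcases hj.eq_or_lt with rfl | h
    · exact le_rfl
    · exact (setup.c_strictMono_low 1 j le_rfl h hjr).le
  · rcases hjr.eq_or_lt with rfl | h
    · exact le_rfl
    · exact (setup.c_strictMono_low j r hj h le_rfl).le

lemma vertexSum_le (setup : StandardSetup G f t r Vset c) (v : V) :
    vertexSum G f v ≤ max G.edgeFinset.card (c r) := by
  by_cases hv : IsPendant G v
  · exact le_max_of_le_left (setup.antimagic.vertexSum_pendant_mem hv).2
  · obtain ⟨j, hj, hvj⟩ := setup.nonpendant_mem v hv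
    have hrt := setup.r_le_t
    rw [Finset.mem_Icc] at hj
    rw [setup.color_on_class j (Finset.mem_Icc.mpr (by omega)) v hvj]
    exact le_max_of_le_right (setup.low_color_mem hj.1 hj.2).2

lemma colorCount_extendLabeling_le (setup : StandardSetup G f t r Vset c) {s i : ℕ} {u : V}
    (hbig : c r ≤ G.edgeFinset.card + s) (hi₁ : r + 1 ≤ i) (hi₂ : i ≤ t)
    (hu : Vset i = {u}) (hec : G.edgeFinset.card < c 1) :
    colorCount (attachPendants G {u} s) (extendLabeling {u} s f G.edgeFinset.card) ≤
      s + (t - r) := by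
  set e := G.edgeFinset.card
  set C := vertexSum (attachPendants G {u} s) (extendLabeling {u} s f e) (Sum.inl u)
  have hsub : Finset.univ.image
      (vertexSum (attachPendants G {u} s) (extendLabeling {u} s f e)) ⊆
      (((Finset.Icc (r + 1) t).erase i).image c ∪ Finset.Icc (e + 1) (e + s)) ∪ {C} := by
    intro n hn
    obtain ⟨x, -, rfl⟩ := Finset.mem_image.mp hn
    rcases x with v | p
    · by_cases hvu : v = u
      · subst hvu
        exact Finset.mem_union_right _ (Finset.mem_singleton_self _)
      · refine Finset.mem_union_left _ ?_
        rw [vertexSum_extendLabeling_inl_of_notMem _ _ _ _ _ (by simpa using hvu)]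
        obtain ⟨j, hj, hvj⟩ := setup.class_cover v
        rw [setup.color_on_class j hj v hvj]
        rw [Finset.mem_Icc] at hj
        by_cases hjr : j ≤ r
        · have := setup.low_color_mem hj.1 hjr
          exact Finset.mem_union_right _ (Finset.mem_Icc.mpr (by omega))
        · refine Finset.mem_union_left _ (Finset.mem_image_of_mem c ?_)
          refine Finset.mem_erase.mpr ⟨?_, Finset.mem_Icc.mpr (by omega)⟩
          rintro rfl
          rw [hu] at hvj
          exact hvu (Finset.mem_singleton.mp hvj)
    · rw [vertexSum_extendLabeling_inr]
      exact Finset.mem_union_left _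
        (Finset.mem_union_right _ (Finset.mem_Icc.mpr (by omega)))
  have hcolors := (Finset.card_le_card hsub).trans (Finset.card_union_le _ _)
  have hunion := Finset.card_union_le (((Finset.Icc (r + 1) t).erase i).image c)
    (Finset.Icc (e + 1) (e + s))
  have himage := Finset.card_image_le (s := (Finset.Icc (r + 1) t).erase i) (f := c)
  rw [Finset.card_erase_of_mem (Finset.mem_Icc.mpr ⟨hi₁, hi₂⟩), Nat.card_Icc] at himage
  rw [Nat.card_Icc] at hunion
  rw [Finset.card_singleton] at hcolors
  simp only [colorCount]
  omega

end StandardSetup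

/-- Theorem 2.2(1): in the standard setup with `r < t`, `G` not
isomorphic to the star `K_{1,e}` and `e + s ≥ c_r` with `s ≥ 1`, for `r + 1 ≤ i ≤ t`
(so `Vᵢ` is a singleton pendant class): if `e < c₁`, then
`χ_la(G(Vᵢ, s)) = s + t - r`. -/
theorem chiLA_attachPendants_singleton_lt_c1 [Fintype V] (G : SimpleGraph V)
    (f : Sym2 V → ℕ) (t r : ℕ) (Vset : ℕ → Finset V) (c : ℕ → ℕ)
    (setup : StandardSetup G f t r Vset c) (hrt : r < t)
    (e s i : ℕ) (he : G.edgeFinset.card = e)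
    (hstar : ¬ Nonempty (G ≃g completeBipartiteGraph (Fin 1) (Fin e)))
    (hs : 1 ≤ s) (hbig : c r ≤ e + s)
    (hi₁ : r + 1 ≤ i) (hi₂ : i ≤ t)
    (hec : e < c 1) :
    chiLA (attachPendants G (Vset i) s) = s + (t - r) := by
  obtain ⟨u, hu, hVi⟩ := setup.pendant_singleton i (Finset.mem_Icc.mpr ⟨hi₁, hi₂⟩)
  rw [hVi]
  subst he
  have hlower : ∀ g, IsLocalAntimagic (attachPendants G {u} s) g →
      s + (t - r) ≤ colorCount (attachPendants G {u} s) g := by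
    intro g hg
    have hedges := edgeFinset_card_of_bijOn
      (bijOn_extendLabeling s G.edgeFinset.card u setup.antimagic.1)
    have hlt := hg.pendantCount_lt_colorCount (by omega)
    have hpendants := pendantCount_add_le (G := G) s u
    have hclasses := setup.sub_le_pendantCount
    omega
  have hlabeling := setup.antimagic.extendLabeling hu hs fun v _ =>
    (setup.vertexSum_le v).trans (max_le (Nat.le_add_right _ _) hbig)
  have hupper := setup.colorCount_extendLabeling_le hbig hi₁ hi₂ hVi hec
  refine le_antisymm (Nat.sInf_le ⟨_, hlabeling, hupper.antisymm (hlower _ hlabeling)⟩) ?_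
  refine le_csInf ⟨_, _, hlabeling, rfl⟩ ?_
  rintro n ⟨g, hg, rfl⟩
  exact hlower g hg

end LocalAntimagic
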